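/- Let n ≥ 3 and let r > 3 be an odd integer; set k = r² and θ = r + 1. Let 0 ≤ a_1 < a_2 < … < a_n < r be integers with gcd(a_i − a_j, r) = 1 for all i ≠ j. Let Γ⁺ = Γ_{k,s⁺} and Γ⁻ = Γ_{k,s⁻}, where s⁺ = (θ^{a_1},…,θ^{a_n}) and s⁻ = (θ^{r−a_1},…,θ^{r−a_n}) (note θ^{r−a_j} ≡ θ^{−a_j} (mod k) since θ^r ≡ 1 (mod r²)). Then d_{Γ⁺}(p,q) = d_{Γ⁻}(p,q) for all p, q ≥ 0; in particular the CR lens spaces L⁺ = L(k; s⁺) and L⁻ = L(k; s⁻) are CR isospectral and F_{L⁺} = F_{L⁻}. -/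

import Mathlib

open MvPolynomial Matrix Complex

noncomputable section

/-- The polynomial ring `ℂ[z_1,…,z_n, z̄_1,…,z̄_n]`. -/
abbrev Rn (n : ℕ) := MvPolynomial (Fin n ⊕ Fin n) ℂ

/-- Weight assigning `(1,0)` to each `z_j` and `(0,1)` to each `z̄_j`. -/
def wt (n : ℕ) : (Fin n ⊕ Fin n) → ℕ × ℕ := Sum.elim (fun _ => (1, 0)) (fun _ => (0, 1))

/-- `𝒫_{p,q}`: polynomials homogeneous of degree `p` in `z` and `q` in `z̄`. -/
def Ppq (n p q : ℕ) : Submodule ℂ (Rn n) :=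
  MvPolynomial.weightedHomogeneousSubmodule ℂ (wt n) (p, q)

/-- `Δ = Σ_j ∂²/∂z_j∂z̄_j`. -/
def DeltaOp (n : ℕ) : Rn n →ₗ[ℂ] Rn n :=
  ∑ j : Fin n, (MvPolynomial.pderiv (Sum.inl j)).toLinearMap ∘ₗ (MvPolynomial.pderiv (Sum.inr j)).toLinearMap

/-- `ℋ_{p,q}`: harmonic polynomials of bidegree `(p,q)`. -/
def Hpq (n p q : ℕ) : Submodule ℂ (Rn n) :=
  Ppq n p q ⊓ LinearMap.ker (DeltaOp n)

/-- The action of a matrix `γ` on `R_n` by the algebra substitution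
`z_i ↦ Σ_j (γ⁻¹)_{ij} z_j`, `z̄_i ↦ Σ_j conj((γ⁻¹)_{ij}) z̄_j`. -/
def matAct (n : ℕ) (γ : Matrix (Fin n) (Fin n) ℂ) : Rn n →ₐ[ℂ] Rn n :=
  MvPolynomial.aeval (Sum.elim
    (fun i => ∑ j, (γ⁻¹ i j) • MvPolynomial.X (Sum.inl j))
    (fun i => ∑ j, (starRingEnd ℂ) (γ⁻¹ i j) • MvPolynomial.X (Sum.inr j)))

/-- The subspace of polynomials fixed by the action of `γ`. -/
def fixedBy (n : ℕ) (γ : Matrix (Fin n) (Fin n) ℂ) : Submodule ℂ (Rn n) :=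
  LinearMap.ker ((matAct n γ).toLinearMap - LinearMap.id)

/-- `ℋ_{p,q}^Γ`, the `Γ`-invariant harmonic polynomials of bidegree `(p,q)`. -/
def HpqInv (n p q : ℕ) (Γ : Subgroup (Matrix.unitaryGroup (Fin n) ℂ)) : Submodule ℂ (Rn n) :=
  Hpq n p q ⊓ ⨅ γ ∈ Γ, fixedBy n ↑γ

/-- `d_Γ(p,q) = dim_ℂ ℋ_{p,q}^Γ`. -/
def dInv (n p q : ℕ) (Γ : Subgroup (Matrix.unitaryGroup (Fin n) ℂ)) : ℕ :=
  Module.finrank ℂ (HpqInv n p q Γ)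

/-- A subgroup of `U(n)` acts freely on `S^{2n-1}` iff no nontrivial element has `1` as an
eigenvalue. -/
def actsFreely (n : ℕ) (Γ : Subgroup (Matrix.unitaryGroup (Fin n) ℂ)) : Prop :=
  ∀ γ ∈ Γ, γ ≠ 1 → ∀ v : Fin n → ℂ, (↑γ : Matrix (Fin n) (Fin n) ℂ).mulVec v = v → v = 0
/-- The standard primitive `k`-th root of unity `ξ_k = exp(2πi/k)`. -/
def xi (k : ℕ) : ℂ := Complex.exp (2 * Real.pi * Complex.I / k)

lemma xi_ne_zero (k : ℕ) : xi k ≠ 0 := Complex.exp_ne_zero _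

lemma star_xi (k : ℕ) : (starRingEnd ℂ) (xi k) = (xi k)⁻¹ := by
  rw [xi, ← Complex.exp_conj, ← Complex.exp_neg]
  congr 1
  rw [map_div₀, _root_.map_mul, _root_.map_mul, Complex.conj_I]
  simp [Complex.conj_ofReal, map_ofNat]
  ring

/-- The generator `γ_{k,s} = diag(ξ_k^{s_1}, …, ξ_k^{s_n})` of a lens group. -/
def lensGen (n : ℕ) (k : ℕ) (s : Fin n → ℤ) : Matrix (Fin n) (Fin n) ℂ :=
  Matrix.diagonal fun i => xi k ^ (s i)

lemma lensGen_mem (n k : ℕ) (s : Fin n → ℤ) :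
    lensGen n k s ∈ Matrix.unitaryGroup (Fin n) ℂ := by
  rw [Matrix.mem_unitaryGroup_iff]
  have hstar : star (lensGen n k s) = Matrix.diagonal fun i => star (xi k ^ (s i)) := by
    rw [lensGen, Matrix.star_eq_conjTranspose, Matrix.diagonal_conjTranspose]
    rfl
  rw [hstar, lensGen, Matrix.diagonal_mul_diagonal]
  convert Matrix.diagonal_one
  rename_i i
  have : (starRingEnd ℂ) (xi k ^ (s i)) = (xi k ^ (s i))⁻¹ := by
    rw [map_zpow₀, star_xi, _root_.inv_zpow]
  rw [RCLike.star_def, this, mul_inv_cancel₀ (zpow_ne_zero _ (xi_ne_zero k))]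

/-- The cyclic subgroup `Γ_{k,s}` of `U(n)` generated by `γ_{k,s}`. -/
def lensSubgroup (n k : ℕ) (s : Fin n → ℤ) : Subgroup (Matrix.unitaryGroup (Fin n) ℂ) :=
  Subgroup.zpowers ⟨lensGen n k s, lensGen_mem n k s⟩

/-- The complete homogeneous symmetric polynomial of degree `p`, evaluated at `x`. -/
def hsum {n : ℕ} (x : Fin n → ℂ) (p : ℕ) : ℂ :=
  ∑ l ∈ Finset.finsuppAntidiag Finset.univ p, ∏ i, x i ^ (l i)

lemma coeff_prod_geometric {n : ℕ} (x : Fin n → ℂ) (p : ℕ) :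
    PowerSeries.coeff p (∏ i, PowerSeries.mk fun m => x i ^ m) = hsum x p := by
  rw [PowerSeries.coeff_prod]
  simp [hsum]

lemma X_sub_C_inv_mul_geometric {x : ℂ} (hx : x ≠ 0) :
    (PowerSeries.X - PowerSeries.C x⁻¹) * (PowerSeries.mk fun m => x ^ m)
      = PowerSeries.C (-x⁻¹) := by
  ext m
  cases m with
  | zero => simp [sub_mul]
  | succ m =>
    simp only [sub_mul, map_sub, PowerSeries.coeff_succ_X_mul, PowerSeries.coeff_mk,
      PowerSeries.coeff_C_mul, PowerSeries.coeff_C]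
    simp [pow_succ', hx]

lemma hsum_add_period {n r : ℕ} (hn : 0 < n) (hr : 0 < r) {x : Fin n → ℂ}
    (hx : Function.Injective x) (hxr : ∀ i, x i ^ r = 1) (p : ℕ) :
    hsum x (p + r) = hsum x p := by
  have hx0 : ∀ i, x i ≠ 0 := fun i h => by simpa [h, hr.ne'] using hxr i
  obtain ⟨P, hP⟩ : (∏ i, (Polynomial.X - Polynomial.C (x i)⁻¹)) ∣
      ((Polynomial.X : Polynomial ℂ) ^ r - 1) := by
    refine Fintype.prod_dvd_of_coprime
      (Polynomial.pairwise_coprime_X_sub_C (inv_injective.comp hx)) fun i => ?_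
    rw [Polynomial.dvd_iff_isRoot]
    simp [hxr i]
  have hP0 : P ≠ 0 := by
    rintro rfl
    exact Polynomial.X_pow_sub_C_ne_zero hr (1 : ℂ) (by simpa using hP)
  have hdeg : P.natDegree < p + r := by
    have h := congrArg Polynomial.natDegree hP
    rw [← Polynomial.C_1, Polynomial.natDegree_X_pow_sub_C, Polynomial.natDegree_mul
      (Polynomial.monic_prod_X_sub_C _ _).ne_zero hP0,
      Polynomial.natDegree_finsetProd_X_sub_C_eq_card, Finset.card_univ, Fintype.card_fin] at h
    omega
  have key : ((PowerSeries.X : PowerSeries ℂ) ^ r - 1) * ∏ i, (PowerSeries.mk fun m => x i ^ m)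
      = (P : PowerSeries ℂ) * PowerSeries.C (∏ i, -(x i)⁻¹) := by
    have h := congrArg (Polynomial.coeToPowerSeries.ringHom (R := ℂ)) hP
    simp only [map_sub, map_mul, map_prod, map_pow, map_one,
      Polynomial.coeToPowerSeries.ringHom_apply, Polynomial.coe_X, Polynomial.coe_C] at h
    rw [h, mul_right_comm, ← Finset.prod_mul_distrib, mul_comm, map_prod]
    congr 1
    exact Finset.prod_congr rfl fun i _ => X_sub_C_inv_mul_geometric (hx0 i)
  have h := congrArg (PowerSeries.coeff (p + r)) key
  rw [sub_mul, map_sub, one_mul, PowerSeries.coeff_X_pow_mul, PowerSeries.coeff_mul_C,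
    Polynomial.coeff_coe, Polynomial.coeff_eq_zero_of_natDegree_lt hdeg, zero_mul,
    coeff_prod_geometric, coeff_prod_geometric] at h
  exact (sub_eq_zero.mp h).symm

lemma hsum_congr_of_modEq {n r : ℕ} (hn : 0 < n) (hr : 0 < r) {x : Fin n → ℂ}
    (hx : Function.Injective x) (hxr : ∀ i, x i ^ r = 1) {p q : ℕ} (hpq : p ≡ q [MOD r]) :
    hsum x p = hsum x q := by
  have h : Function.Periodic (hsum x) r := hsum_add_period hn hr hx hxr
  rw [← h.map_mod_nat p, ← h.map_mod_nat q, hpq]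

lemma hsum_mul {n : ℕ} (c : ℂ) (x : Fin n → ℂ) (p : ℕ) :
    hsum (fun i => c * x i) p = c ^ p * hsum x p := by
  rw [hsum, hsum, Finset.mul_sum]
  refine Finset.sum_congr rfl fun l hl => ?_
  rw [Finset.mem_finsuppAntidiag] at hl
  simp only [mul_pow, Finset.prod_mul_distrib, Finset.prod_pow_eq_pow_sum, hl.1]

lemma hsum_mul_hsum_inv_comm {n r : ℕ} (hn : 0 < n) (hr : 0 < r) {a : Fin n → ℕ}
    (hgcd : ∀ i j, i ≠ j → Int.gcd ((a i : ℤ) - (a j : ℤ)) r = 1) {y : ℂ} (hy : y ^ r = 1)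
    {p q : ℕ} (hpq : p ≡ q [MOD r]) :
    hsum (fun i => y ^ a i) p * hsum (fun i => (y ^ a i)⁻¹) q
      = hsum (fun i => (y ^ a i)⁻¹) p * hsum (fun i => y ^ a i) q := by
  by_cases hy1 : y = 1
  · simp [hy1]
  have hy0 : y ≠ 0 := fun h => by simp [h, hr.ne'] at hy
  have hinj : Function.Injective fun i => y ^ a i := by
    intro i j hij
    by_contra hne
    have h1 : y ^ ((a i : ℤ) - a j) = 1 := by
      rw [zpow_sub₀ hy0, zpow_natCast, zpow_natCast]
      exact (div_eq_one_iff_eq (pow_ne_zero _ hy0)).mpr hij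
    have h2 : y ^ (r : ℤ) = 1 := by rw [zpow_natCast, hy]
    have h3 := Int.gcd_eq_gcd_ab ((a i : ℤ) - a j) r
    rw [hgcd i j hne] at h3
    apply hy1
    calc y = y ^ (((1 : ℕ) : ℤ)) := by simp
      _ = 1 := by rw [h3, zpow_add₀ hy0, _root_.zpow_mul, _root_.zpow_mul, h1, h2]; simp
  have hpow : ∀ i, (y ^ a i) ^ r = 1 := fun i => by rw [← pow_mul, mul_comm, pow_mul, hy, one_pow]
  rw [hsum_congr_of_modEq hn hr hinj hpow hpq,
    hsum_congr_of_modEq hn hr (x := fun i => (y ^ a i)⁻¹) (inv_injective.comp hinj)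
      (fun i => by rw [inv_pow, hpow, inv_one]) hpq, mul_comm]

/-- The pairs of exponents `(α, β)` of degrees `p` and `q` with `∑ s_i (α_i - β_i) = 0`
modulo `k`. -/
def invExponents (n k : ℕ) (s : Fin n → ℤ) (p q : ℕ) : Finset ((Fin n →₀ ℕ) × (Fin n →₀ ℕ)) :=
  (Finset.finsuppAntidiag Finset.univ p ×ˢ Finset.finsuppAntidiag Finset.univ q).filter
    fun x => (k : ℤ) ∣ ∑ i, s i * ((x.1 i : ℤ) - x.2 i)

lemma isPrimitiveRoot_xi {k : ℕ} (hk : k ≠ 0) : IsPrimitiveRoot (xi k) k :=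
  Complex.isPrimitiveRoot_exp k hk

lemma sum_xi_zpow {k : ℕ} (hk : k ≠ 0) (u : ℤ) :
    ∑ d ∈ Finset.range k, (xi k ^ u) ^ d = if (k : ℤ) ∣ u then (k : ℂ) else 0 := by
  have hxi := isPrimitiveRoot_xi hk
  split_ifs with h
  · simp [(hxi.zpow_eq_one_iff_dvd u).mpr h]
  · have h1 : xi k ^ u ≠ 1 := fun h' => h ((hxi.zpow_eq_one_iff_dvd u).mp h')
    have h2 : (xi k ^ u) ^ k = 1 := by
      rw [← zpow_natCast, ← _root_.zpow_mul, mul_comm, _root_.zpow_mul, zpow_natCast,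
        hxi.pow_eq_one, _root_.one_zpow]
    rw [geom_sum_eq h1, h2]
    simp

lemma xi_zpow_sum {ι : Type*} (k : ℕ) (t : Finset ι) (f : ι → ℤ) :
    xi k ^ (∑ i ∈ t, f i) = ∏ i ∈ t, xi k ^ f i := by
  classical
  induction t using Finset.induction_on with
  | empty => simp
  | insert i t hi ih =>
    rw [Finset.sum_insert hi, Finset.prod_insert hi, zpow_add₀ (xi_ne_zero k), ih]

lemma card_invExponents_mul {n k : ℕ} (hk : k ≠ 0) (s : Fin n → ℤ) (p q : ℕ) :
    ((invExponents n k s p q).card : ℂ) * k = ∑ d ∈ Finset.range k,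
      hsum (fun i => (xi k ^ s i) ^ d) p * hsum (fun i => ((xi k ^ s i) ^ d)⁻¹) q := by
  have hx := xi_ne_zero k
  simp only [hsum, Finset.sum_mul_sum]
  simp only [← Finset.sum_product']
  rw [Finset.sum_product]
  rw [Finset.sum_comm, invExponents, Finset.card_filter]
  push_cast
  rw [Finset.sum_mul]
  refine Finset.sum_congr rfl fun x _ => ?_
  rw [ite_mul, one_mul, zero_mul, ← sum_xi_zpow hk]
  refine Finset.sum_congr rfl fun d _ => ?_
  rw [← Finset.prod_mul_distrib, xi_zpow_sum, ← Finset.prod_pow]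
  refine Finset.prod_congr rfl fun i _ => ?_
  rw [mul_sub, zpow_sub₀ hx, _root_.zpow_mul, _root_.zpow_mul, zpow_natCast, zpow_natCast,
    div_eq_mul_inv, mul_pow, inv_pow, inv_pow, pow_right_comm, pow_right_comm (xi k ^ s i) (x.2 i)]

lemma invExponents_congr {n k : ℕ} {s t : Fin n → ℤ} (h : ∀ i, s i ≡ t i [ZMOD k]) (p q : ℕ) :
    invExponents n k s p q = invExponents n k t p q := by
  refine Finset.filter_congr fun x _ => ?_
  rw [← ZMod.intCast_zmod_eq_zero_iff_dvd, ← ZMod.intCast_zmod_eq_zero_iff_dvd]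
  have h' : ∀ i, (s i : ZMod k) = t i := fun i => (ZMod.intCast_eq_intCast_iff _ _ _).mpr (h i)
  simp [h']

lemma card_invExponents_eq {n r : ℕ} (hn : 0 < n) (hr : 0 < r) {a : Fin n → ℕ}
    (hgcd : ∀ i j, i ≠ j → Int.gcd ((a i : ℤ) - (a j : ℤ)) r = 1) (p q : ℕ) :
    (invExponents n (r ^ 2) (fun i => 1 + r * a i) p q).card
      = (invExponents n (r ^ 2) (fun i => 1 - r * a i) p q).card := by
  by_cases hpq : p ≡ q [MOD r]
  · have hk : r ^ 2 ≠ 0 := pow_ne_zero _ hr.ne'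
    have hx := xi_ne_zero (r ^ 2)
    have hkC : ((r ^ 2 : ℕ) : ℂ) ≠ 0 := by exact_mod_cast hk
    have hxr : (xi (r ^ 2) ^ r) ^ r = 1 := by
      rw [← pow_mul, ← sq, (isPrimitiveRoot_xi hk).pow_eq_one]
    rw [← Nat.cast_inj (R := ℂ), ← mul_left_inj' hkC, card_invExponents_mul hk,
      card_invExponents_mul hk]
    refine Finset.sum_congr rfl fun d _ => ?_
    have h1 : ∀ i, (xi (r ^ 2) ^ (1 + (r : ℤ) * a i)) ^ d
        = xi (r ^ 2) ^ d * ((xi (r ^ 2) ^ r) ^ d) ^ a i := fun i => by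
      rw [zpow_add₀ hx, zpow_one, _root_.zpow_mul, zpow_natCast, zpow_natCast, mul_pow, pow_right_comm]
    have h2 : ∀ i, (xi (r ^ 2) ^ (1 - (r : ℤ) * a i)) ^ d
        = xi (r ^ 2) ^ d * (((xi (r ^ 2) ^ r) ^ d) ^ a i)⁻¹ := fun i => by
      rw [zpow_sub₀ hx, zpow_one, _root_.zpow_mul, zpow_natCast, zpow_natCast, div_eq_mul_inv, mul_pow,
        inv_pow, pow_right_comm]
    simp only [h1, h2, mul_inv, inv_inv, hsum_mul]
    have h3 := hsum_mul_hsum_inv_comm hn hr hgcd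
      (y := (xi (r ^ 2) ^ r) ^ d) (by rw [pow_right_comm, hxr, one_pow]) hpq
    rw [mul_mul_mul_comm, h3, mul_mul_mul_comm]
  · have hempty : ∀ b : Fin n → ℤ, invExponents n (r ^ 2) (fun i => 1 + r * b i) p q = ∅ := by
      intro b
      refine Finset.filter_eq_empty_iff.mpr fun x hx hdvd => hpq ?_
      simp only [Finset.mem_product, Finset.mem_finsuppAntidiag] at hx
      have hp : ∑ i, (x.1 i : ℤ) = p := by exact_mod_cast hx.1.1
      have hq : ∑ i, (x.2 i : ℤ) = q := by exact_mod_cast hx.2.1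
      have hs : ∑ i, (1 + (r : ℤ) * b i) * ((x.1 i : ℤ) - x.2 i)
          = p - q + r * ∑ i, b i * ((x.1 i : ℤ) - x.2 i) := by
        rw [← hp, ← hq, ← Finset.sum_sub_distrib, Finset.mul_sum, ← Finset.sum_add_distrib]
        exact Finset.sum_congr rfl fun i _ => by ring
      have hr2 : (r : ℤ) ∣ ((r ^ 2 : ℕ) : ℤ) := by exact_mod_cast dvd_pow_self r two_ne_zero
      rw [hs] at hdvd
      exact (Nat.modEq_iff_dvd.mpr ((dvd_add_left (dvd_mul_right _ _)).mp (hr2.trans hdvd))).symm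
    have h := hempty fun i => -(a i : ℤ)
    simp only [mul_neg, ← sub_eq_add_neg] at h
    rw [hempty, h]

lemma one_add_pow_modEq (r m : ℕ) :
    ((r + 1 : ℕ) : ℤ) ^ m ≡ 1 + r * m [ZMOD (r ^ 2 : ℕ)] := by
  induction m with
  | zero => simp
  | succ m ih =>
    rw [pow_succ _ m]
    refine (ih.mul_right _).trans ?_
    rw [Int.modEq_iff_dvd]
    push_cast
    exact ⟨-m, by ring⟩

lemma one_add_pow_sub_modEq {r m : ℕ} (h : m ≤ r) :
    ((r + 1 : ℕ) : ℤ) ^ (r - m) ≡ 1 - r * m [ZMOD (r ^ 2 : ℕ)] := by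
  refine (one_add_pow_modEq r (r - m)).trans ?_
  rw [Int.modEq_iff_dvd]
  push_cast [Nat.cast_sub h]
  exact ⟨-1, by ring⟩

/-- The grading of `Rn n` by bidegree and by the character of `γ_{k,s}`. -/
def lensWeight (n k : ℕ) (s : Fin n → ℤ) : Fin n ⊕ Fin n → ℕ × ℕ × ZMod k :=
  Sum.elim (fun i => (1, 0, (s i : ZMod k))) (fun i => (0, 1, -(s i : ZMod k)))

lemma lensGen_inv (n k : ℕ) (s : Fin n → ℤ) : (lensGen n k s)⁻¹ = lensGen n k (-s) := by
  apply Matrix.inv_eq_right_inv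
  simp only [lensGen, Matrix.diagonal_mul_diagonal, ← zpow_add₀ (xi_ne_zero k)]
  simp

lemma matAct_lensGen_X (n k : ℕ) (s : Fin n → ℤ) (v : Fin n ⊕ Fin n) :
    matAct n (lensGen n k s) (X v) = C (xi k ^ (Sum.elim (-s) s v)) * X v := by
  rw [matAct, lensGen_inv, aeval_X]
  cases v with
  | inl i => simp [lensGen, Matrix.diagonal_apply, ite_smul, MvPolynomial.smul_eq_C_mul]
  | inr i =>
    simp [lensGen, Matrix.diagonal_apply, ite_smul, MvPolynomial.smul_eq_C_mul, apply_ite, star_xi]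

lemma matAct_lensGen_monomial (n k : ℕ) (s : Fin n → ℤ) (d : Fin n ⊕ Fin n →₀ ℕ) (c : ℂ) :
    matAct n (lensGen n k s) (monomial d c)
      = monomial d (xi k ^ (-∑ i, s i * ((d (Sum.inl i) : ℤ) - d (Sum.inr i))) * c) := by
  have hexp : -∑ i, s i * ((d (Sum.inl i) : ℤ) - d (Sum.inr i))
      = ∑ v, Sum.elim (-s) s v * (d v : ℤ) := by
    rw [Fintype.sum_sum_type, ← Finset.sum_neg_distrib, ← Finset.sum_add_distrib]
    exact Finset.sum_congr rfl fun i _ => by simp; ring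
  rw [MvPolynomial.monomial_eq, MvPolynomial.monomial_eq, map_mul,
    Finsupp.prod_fintype _ _ (by simp), map_prod, algHom_C, hexp, xi_zpow_sum, C_mul, map_prod]
  simp only [map_pow, matAct_lensGen_X, mul_pow, Finset.prod_mul_distrib,
    _root_.zpow_mul, zpow_natCast]
  rw [MvPolynomial.algebraMap_eq]
  ring

lemma coeff_matAct_lensGen (n k : ℕ) (s : Fin n → ℤ) (d : Fin n ⊕ Fin n →₀ ℕ) (P : Rn n) :
    coeff d (matAct n (lensGen n k s) P)
      = xi k ^ (-∑ i, s i * ((d (Sum.inl i) : ℤ) - d (Sum.inr i))) * coeff d P := by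
  induction P using MvPolynomial.induction_on' with
  | monomial e c =>
    rw [matAct_lensGen_monomial, coeff_monomial, coeff_monomial]
    split_ifs with h
    · rw [h]
    · simp
  | add P Q hP hQ => rw [map_add, coeff_add, coeff_add, hP, hQ, mul_add]

lemma lensGen_zpow (n k : ℕ) (s : Fin n → ℤ) (m : ℤ) :
    (⟨lensGen n k s, lensGen_mem n k s⟩ : Matrix.unitaryGroup (Fin n) ℂ) ^ m
      = ⟨lensGen n k (m • s), lensGen_mem n k (m • s)⟩ := by
  have hmul : ∀ t : Fin n → ℤ, (⟨lensGen n k (t + s), lensGen_mem n k (t + s)⟩ :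
      Matrix.unitaryGroup (Fin n) ℂ)
      = ⟨lensGen n k t, lensGen_mem n k t⟩ * ⟨lensGen n k s, lensGen_mem n k s⟩ := fun t => by
    ext1
    simp [lensGen, zpow_add₀ (xi_ne_zero k)]
  induction m using Int.induction_on with
  | zero =>
    ext1
    simp [lensGen]
  | succ m ih => rw [_root_.zpow_add_one, ih, ← hmul, add_smul, one_smul]
  | pred m ih => rw [_root_.zpow_sub_one, ih, mul_inv_eq_iff_eq_mul, ← hmul, sub_smul, one_smul,
      sub_add_cancel]

lemma mem_fixedBy_lensGen {n k : ℕ} (hk : k ≠ 0) (s : Fin n → ℤ) (P : Rn n) :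
    P ∈ fixedBy n (lensGen n k s) ↔ ∀ d, coeff d P ≠ 0 →
      (k : ℤ) ∣ ∑ i, s i * ((d (Sum.inl i) : ℤ) - d (Sum.inr i)) := by
  rw [fixedBy, LinearMap.mem_ker, LinearMap.sub_apply, sub_eq_zero, MvPolynomial.ext_iff]
  refine forall_congr' fun d => ?_
  rw [AlgHom.toLinearMap_apply, coeff_matAct_lensGen, LinearMap.id_apply, mul_left_eq_self₀,
    (isPrimitiveRoot_xi hk).zpow_eq_one_iff_dvd, dvd_neg]
  tauto

lemma mem_iInf_fixedBy_lensSubgroup {n k : ℕ} (hk : k ≠ 0) (s : Fin n → ℤ) (P : Rn n) :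
    (P ∈ ⨅ γ ∈ lensSubgroup n k s, fixedBy n ↑γ) ↔ ∀ d, coeff d P ≠ 0 →
      (k : ℤ) ∣ ∑ i, s i * ((d (Sum.inl i) : ℤ) - d (Sum.inr i)) := by
  simp only [Submodule.mem_iInf]
  constructor
  · intro h
    exact (mem_fixedBy_lensGen hk s P).mp
      (h ⟨lensGen n k s, lensGen_mem n k s⟩ (Subgroup.mem_zpowers _))
  · intro h γ hγ
    obtain ⟨m, hm⟩ := Subgroup.mem_zpowers_iff.mp hγ
    rw [← hm, lensGen_zpow]
    refine (mem_fixedBy_lensGen hk _ P).mpr fun d hd => ?_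
    simp only [Pi.smul_apply, smul_eq_mul, mul_assoc, ← Finset.mul_sum]
    exact (h d hd).mul_left m

lemma weight_wt_eq_iff {n : ℕ} (d : Fin n ⊕ Fin n →₀ ℕ) (p q : ℕ) :
    Finsupp.weight (wt n) d = (p, q) ↔
      ∑ i, d (Sum.inl i) = p ∧ ∑ i, d (Sum.inr i) = q := by
  simp [Finsupp.weight_eq_sum, Fintype.sum_sum_type, wt, Prod.ext_iff, Prod.fst_sum, Prod.snd_sum]

lemma weight_lensWeight_eq_iff {n k : ℕ} (s : Fin n → ℤ) (d : Fin n ⊕ Fin n →₀ ℕ) (p q : ℕ) :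
    Finsupp.weight (lensWeight n k s) d = (p, q, 0) ↔
      (∑ i, d (Sum.inl i) = p ∧ ∑ i, d (Sum.inr i) = q) ∧
        (k : ℤ) ∣ ∑ i, s i * ((d (Sum.inl i) : ℤ) - d (Sum.inr i)) := by
  rw [← ZMod.intCast_zmod_eq_zero_iff_dvd]
  simp [Finsupp.weight_eq_sum, Fintype.sum_sum_type, lensWeight, Prod.ext_iff, Prod.fst_sum,
    Prod.snd_sum, and_assoc, mul_sub, mul_comm, ← sub_eq_add_neg]

lemma HpqInv_lensSubgroup {n k : ℕ} (hk : k ≠ 0) (s : Fin n → ℤ) (p q : ℕ) :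
    HpqInv n p q (lensSubgroup n k s)
      = weightedHomogeneousSubmodule ℂ (lensWeight n k s) (p, q, 0) ⊓
        LinearMap.ker (DeltaOp n) := by
  ext P
  rw [HpqInv, Hpq, Ppq, inf_right_comm, Submodule.mem_inf, Submodule.mem_inf, Submodule.mem_inf,
    mem_iInf_fixedBy_lensSubgroup hk, mem_weightedHomogeneousSubmodule,
    mem_weightedHomogeneousSubmodule, IsWeightedHomogeneous, IsWeightedHomogeneous]
  simp only [weight_wt_eq_iff, weight_lensWeight_eq_iff, ← forall_and]

/-- The monomials of weight `(p, q, 0)` correspond to the pairs in `invExponents`. -/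
def weightEquivInvExponents (n k : ℕ) (s : Fin n → ℤ) (p q : ℕ) :
    {d : Fin n ⊕ Fin n →₀ ℕ | Finsupp.weight (lensWeight n k s) d = (p, q, 0)} ≃
      invExponents n k s p q :=
  Finsupp.sumFinsuppEquivProdFinsupp.subtypeEquiv fun d => by
    simp only [Set.mem_ofPred_eq, weight_lensWeight_eq_iff, invExponents, Finset.mem_filter,
      Finset.mem_product, Finset.mem_finsuppAntidiag, Finset.subset_univ, and_true]
    rfl

lemma weightedHomogeneousSubmodule_eq_restrictSupport (n k : ℕ) (s : Fin n → ℤ)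
    (m : ℕ × ℕ × ZMod k) : weightedHomogeneousSubmodule ℂ (lensWeight n k s) m
      = restrictSupport ℂ {d | Finsupp.weight (lensWeight n k s) d = m} :=
  weightedHomogeneousSubmodule_eq_finsupp_supported ..

lemma finrank_weightedHomogeneousSubmodule_lensWeight (n k : ℕ) (s : Fin n → ℤ) (p q : ℕ) :
    Module.finrank ℂ (weightedHomogeneousSubmodule ℂ (lensWeight n k s) (p, q, 0))
      = (invExponents n k s p q).card := by
  rw [weightedHomogeneousSubmodule_eq_restrictSupport,
    Module.finrank_eq_nat_card_basis (basisRestrictSupport ℂ _), ← Nat.card_eq_finsetCard]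
  exact Nat.card_congr (weightEquivInvExponents n k s p q)

lemma finite_weightedHomogeneousSubmodule_lensWeight (n k : ℕ) (s : Fin n → ℤ) (p q : ℕ) :
    Module.Finite ℂ (weightedHomogeneousSubmodule ℂ (lensWeight n k s) (p, q, 0)) := by
  rw [weightedHomogeneousSubmodule_eq_restrictSupport]
  have := Finite.of_equiv _ (weightEquivInvExponents n k s p q).symm
  exact Module.Finite.of_basis (basisRestrictSupport ℂ _)

lemma DeltaOp_monomial (n : ℕ) (d : Fin n ⊕ Fin n →₀ ℕ) (c : ℂ) :
    DeltaOp n (monomial d c) = ∑ j, monomial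
      (d - Finsupp.single (Sum.inr j) 1 - Finsupp.single (Sum.inl j) 1)
      (c * d (Sum.inr j) * d (Sum.inl j)) := by
  rw [DeltaOp, LinearMap.sum_apply]
  refine Finset.sum_congr rfl fun j _ => ?_
  simp [pderiv_monomial]

lemma lensWeight_inl_add_inr (n k : ℕ) (s : Fin n → ℤ) (j : Fin n) :
    lensWeight n k s (Sum.inl j) + lensWeight n k s (Sum.inr j) = (1, 1, 0) := by
  simp [lensWeight]

lemma DeltaOp_mem {n k : ℕ} {s : Fin n → ℤ} {m : ℕ × ℕ × ZMod k} {P : Rn n}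
    (hP : P ∈ weightedHomogeneousSubmodule ℂ (lensWeight n k s) (m + (1, 1, 0))) :
    DeltaOp n P ∈ weightedHomogeneousSubmodule ℂ (lensWeight n k s) m := by
  rw [DeltaOp, LinearMap.sum_apply]
  refine Submodule.sum_mem _ fun j _ => ?_
  refine IsWeightedHomogeneous.pderiv (IsWeightedHomogeneous.pderiv hP
    (n' := m + lensWeight n k s (Sum.inl j)) ?_) rfl
  rw [add_assoc, lensWeight_inl_add_inr]

lemma monomial_mem_map_DeltaOp {n k : ℕ} (j₀ : Fin n) (s : Fin n → ℤ) (m : ℕ × ℕ × ZMod k)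
    (N : ℕ) : ∀ (d : Fin n ⊕ Fin n →₀ ℕ) (c : ℂ), Finsupp.weight (lensWeight n k s) d = m →
      ∑ j ∈ Finset.univ.erase j₀, d (Sum.inl j) = N →
      monomial d c ∈ (weightedHomogeneousSubmodule ℂ (lensWeight n k s) (m + (1, 1, 0))).map
        (DeltaOp n) := by
  induction N using Nat.strong_induction_on with
  | _ N ih =>
    intro d c hd hN
    set e : Fin n ⊕ Fin n →₀ ℕ :=
      d + Finsupp.single (Sum.inl j₀) 1 + Finsupp.single (Sum.inr j₀) 1 with he
    have hwe : Finsupp.weight (lensWeight n k s) e = m + (1, 1, 0) := by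
      rw [he, map_add, map_add, Finsupp.weight_single, Finsupp.weight_single, one_smul, one_smul,
        add_assoc, lensWeight_inl_add_inr, hd]
    set c' : ℂ := c / ((d (Sum.inr j₀) + 1) * (d (Sum.inl j₀) + 1)) with hc'
    have hmain : monomial d c = DeltaOp n (monomial e c') -
        ∑ j ∈ Finset.univ.erase j₀, monomial
          (e - Finsupp.single (Sum.inr j) 1 - Finsupp.single (Sum.inl j) 1)
          (c' * e (Sum.inr j) * e (Sum.inl j)) := by
      rw [DeltaOp_monomial, ← Finset.add_sum_erase _ _ (Finset.mem_univ j₀), add_sub_cancel_right]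
      have h1 : (d (Sum.inr j₀) : ℂ) + 1 ≠ 0 := Nat.cast_add_one_ne_zero _
      have h2 : (d (Sum.inl j₀) : ℂ) + 1 ≠ 0 := Nat.cast_add_one_ne_zero _
      congr 2
      · rw [he, add_tsub_cancel_right, add_tsub_cancel_right]
      · simp only [he, hc', Finsupp.add_apply, Finsupp.single_apply]
        simp
        field_simp
    rw [hmain]
    refine Submodule.sub_mem _ (Submodule.mem_map_of_mem ?_) (Submodule.sum_mem _ fun j hj => ?_)
    · exact isWeightedHomogeneous_monomial _ _ _ hwe
    have hjne : j ≠ j₀ := Finset.ne_of_mem_erase hj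
    by_cases hr : e (Sum.inr j) = 0
    · simp [hr]
    by_cases hl : e (Sum.inl j) = 0
    · simp [hl]
    have hl' : (e - Finsupp.single (Sum.inr j) 1 : Fin n ⊕ Fin n →₀ ℕ) (Sum.inl j) ≠ 0 := by
      simpa using hl
    refine ih _ ?_ _ _ ?_ rfl
    · rw [← hN]
      have hdl : ∀ i ∈ Finset.univ.erase j₀,
          (e - Finsupp.single (Sum.inr j) 1 - Finsupp.single (Sum.inl j) 1 :
            Fin n ⊕ Fin n →₀ ℕ) (Sum.inl i)
            = d (Sum.inl i) - if j = i then 1 else 0 := fun i hi => by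
        have := (Finset.ne_of_mem_erase hi).symm
        simp [he, Finsupp.single_apply, this]
      have hdj : d (Sum.inl j) ≠ 0 := by
        simpa [he, Finsupp.single_apply, hjne.symm] using hl
      rw [Finset.sum_congr rfl hdl]
      refine Finset.sum_lt_sum (fun i _ => Nat.sub_le _ _) ⟨j, hj, ?_⟩
      simp
      omega
    · have h1 := Finsupp.weight_sub_single_add (w := lensWeight n k s) hr
      have h2 := Finsupp.weight_sub_single_add (w := lensWeight n k s) hl'
      rw [← h2, add_assoc, lensWeight_inl_add_inr, hwe] at h1
      exact add_right_cancel h1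

lemma map_DeltaOp_weightedHomogeneousSubmodule {n k : ℕ} (hn : 0 < n) (s : Fin n → ℤ)
    (m : ℕ × ℕ × ZMod k) :
    (weightedHomogeneousSubmodule ℂ (lensWeight n k s) (m + (1, 1, 0))).map (DeltaOp n)
      = weightedHomogeneousSubmodule ℂ (lensWeight n k s) m := by
  apply le_antisymm
  · exact Submodule.map_le_iff_le_comap.mpr fun P hP => DeltaOp_mem hP
  · intro P hP
    rw [P.as_sum]
    exact Submodule.sum_mem _ fun d hd =>
      monomial_mem_map_DeltaOp ⟨0, hn⟩ s m _ d _ (hP (mem_support_iff.mp hd)) rfl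

lemma dInv_lensSubgroup_succ_add {n k : ℕ} (hn : 0 < n) (hk : k ≠ 0) (s : Fin n → ℤ) (p q : ℕ) :
    (invExponents n k s p q).card + dInv n (p + 1) (q + 1) (lensSubgroup n k s)
      = (invExponents n k s (p + 1) (q + 1)).card := by
  have hfin := finite_weightedHomogeneousSubmodule_lensWeight n k s (p + 1) (q + 1)
  have h := ((DeltaOp n).domRestrict (weightedHomogeneousSubmodule ℂ (lensWeight n k s)
    (p + 1, q + 1, 0))).finrank_range_add_finrank_ker
  have hmap := map_DeltaOp_weightedHomogeneousSubmodule hn s ((p, q, 0) : ℕ × ℕ × ZMod k)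
  rw [Prod.mk_add_mk, Prod.mk_add_mk, add_zero] at hmap
  rw [LinearMap.range_domRestrict, hmap, finrank_weightedHomogeneousSubmodule_lensWeight,
    finrank_weightedHomogeneousSubmodule_lensWeight, LinearMap.domRestrict, LinearMap.ker_comp,
    ← Submodule.finrank_map_subtype_eq, Submodule.map_comap_subtype] at h
  rw [dInv, HpqInv_lensSubgroup hk, h]

lemma dInv_lensSubgroup_of_eq_zero {n k : ℕ} (hk : k ≠ 0) (s : Fin n → ℤ) {p q : ℕ}
    (h : p = 0 ∨ q = 0) :
    dInv n p q (lensSubgroup n k s) = (invExponents n k s p q).card := by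
  rw [dInv, HpqInv_lensSubgroup hk, inf_eq_left.mpr,
    finrank_weightedHomogeneousSubmodule_lensWeight]
  intro P hP
  rw [LinearMap.mem_ker, P.as_sum, map_sum]
  refine Finset.sum_eq_zero fun d hd => ?_
  have hd' := ((weight_lensWeight_eq_iff s d p q).mp (hP (mem_support_iff.mp hd))).1
  rw [DeltaOp_monomial]
  refine Finset.sum_eq_zero fun j _ => ?_
  rcases h with rfl | rfl
  · simp [Finset.sum_eq_zero_iff.mp hd'.1 j (Finset.mem_univ j)]
  · simp [Finset.sum_eq_zero_iff.mp hd'.2 j (Finset.mem_univ j)]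

lemma dInv_lensSubgroup_congr {n k : ℕ} (hn : 0 < n) (hk : k ≠ 0) {s t : Fin n → ℤ}
    (h : ∀ p q, (invExponents n k s p q).card = (invExponents n k t p q).card) (p q : ℕ) :
    dInv n p q (lensSubgroup n k s) = dInv n p q (lensSubgroup n k t) := by
  rcases p with _ | p
  · simp only [dInv_lensSubgroup_of_eq_zero hk _ (Or.inl rfl), h]
  rcases q with _ | q
  · simp only [dInv_lensSubgroup_of_eq_zero hk _ (Or.inr rfl), h]
  have hs := dInv_lensSubgroup_succ_add hn hk s p q
  have ht := dInv_lensSubgroup_succ_add hn hk t p q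
  have h0 := h p q
  have h1 := h (p + 1) (q + 1)
  omega

/-- **A large family of CR isospectral pairs** (DeFord–Doyle type construction).
For `n ≥ 3`, odd `r > 3`, `k = r²`, `θ = r + 1`, and `0 ≤ a_1 < … < a_n < r` with
`gcd(a_i - a_j, r) = 1` for `i ≠ j`, the lens spaces `L⁺ = L(r²; θ^{a_1},…,θ^{a_n})` and
`L⁻ = L(r²; θ^{r-a_1},…,θ^{r-a_n})` satisfy `d_{Γ⁺}(p,q) = d_{Γ⁻}(p,q)` for all `p,q`,
hence are CR isospectral. -/
theorem isospectral_pairs_family (n r : ℕ) (hn : 3 ≤ n) (hr : 3 < r) (hodd : Odd r)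
    (a : Fin n → ℕ) (hmono : StrictMono a) (har : ∀ i, a i < r)
    (hgcd : ∀ i j, i ≠ j → Int.gcd ((a i : ℤ) - (a j : ℤ)) r = 1) :
    ∀ p q : ℕ,
      dInv n p q (lensSubgroup n (r ^ 2) (fun i => ((r + 1 : ℕ) : ℤ) ^ (a i)))
        = dInv n p q (lensSubgroup n (r ^ 2) (fun i => ((r + 1 : ℕ) : ℤ) ^ (r - a i))) := by
  have hn0 : 0 < n := by omega
  have hr0 : 0 < r := by omega
  refine dInv_lensSubgroup_congr hn0 (pow_ne_zero 2 hr0.ne') fun p q => ?_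
  rw [invExponents_congr (fun i => one_add_pow_modEq r (a i)),
    invExponents_congr (fun i => one_add_pow_sub_modEq (har i).le)]
  exact card_invExponents_eq hn0 hr0 hgcd p q

end
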